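/- Let (x₀,y₀,z₀) ∈ ℝ³ satisfy x₀ + y₀ + z₀ = −1, x₀ ≤ 0, y₀ ≤ 0, z₀ ≤ 0, x₀² + y₀² + z₀² > 1/2, y₀ > −1/2, and z₀ > −1/2. Then there exists (A₀,B₀,C₀) ∈ ℝ³ such that A₀·x₀ + B₀·y₀ + C₀·z₀ < 0, A₀B₀ + A₀C₀ + B₀C₀ > 0, B₀ < 0, and C₀ < 0. -/

import Mathlib

/-- A binary quadratic form `q b² - d b c + r c²` with nonnegative outer coefficients, `d > 0`
and positive discriminant takes a negative value in the open positive quadrant. -/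
theorem exists_pos_quadratic_form_neg {q r d : ℝ} (hq : 0 ≤ q) (hd : 0 < d)
    (hdisc : 4 * q * r < d ^ 2) :
    ∃ b c : ℝ, 0 < b ∧ 0 < c ∧ q * b ^ 2 - d * b * c + r * c ^ 2 < 0 := by
  rcases hq.eq_or_lt with rfl | hq
  · refine ⟨|r| + 1, d, by positivity, hd, ?_⟩
    nlinarith [mul_nonneg (sq_nonneg d) (sub_nonneg.2 (le_abs_self r)), pow_pos hd 2]
  · refine ⟨d, 2 * q, hd, by positivity, ?_⟩
    nlinarith [mul_pos hq (sub_pos.2 hdisc)]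

theorem exists_separating_direction
    (x₀ y₀ z₀ : ℝ)
    (hsum : x₀ + y₀ + z₀ = -1)
    (hx : x₀ ≤ 0) (hy : y₀ ≤ 0) (hz : z₀ ≤ 0)
    (houtside : x₀ ^ 2 + y₀ ^ 2 + z₀ ^ 2 > 1 / 2)
    (hy' : y₀ > -1 / 2) (hz' : z₀ > -1 / 2) :
    ∃ A₀ B₀ C₀ : ℝ,
      A₀ * x₀ + B₀ * y₀ + C₀ * z₀ < 0 ∧
      A₀ * B₀ + A₀ * C₀ + B₀ * C₀ > 0 ∧
      B₀ < 0 ∧ C₀ < 0 := by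
  have hx' : x₀ < -1 / 2 := by
    by_contra! h
    nlinarith [mul_nonneg (neg_nonneg.2 hx) (sub_nonneg.2 h),
      mul_nonneg (neg_nonneg.2 hy) (sub_pos.2 hy').le,
      mul_nonneg (neg_nonneg.2 hz) (sub_pos.2 hz').le]
  have hsq : (x₀ + y₀ + z₀) ^ 2 = 1 := by rw [hsum]; norm_num
  obtain ⟨b, c, hb, hc, hbc⟩ := exists_pos_quadratic_form_neg (q := -y₀) (r := -z₀)
    (d := y₀ + z₀ - x₀) (by linarith) (by linarith) (by nlinarith)
  have hlt : (b * -y₀ + c * -z₀) / -x₀ < b * c / (b + c) := by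
    rw [div_lt_div_iff₀ (by linarith) (by positivity)]
    nlinarith
  obtain ⟨A, hA₁, hA₂⟩ := exists_between hlt
  rw [div_lt_iff₀ (by linarith)] at hA₁
  rw [lt_div_iff₀ (by positivity)] at hA₂
  exact ⟨A, -b, -c, by linarith, by linarith, by linarith, by linarith⟩
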